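/- Let δ ∈ (0,1/2) and set ρ = 1/2 − √(δ(1−δ)). Then R₄(δ) ≤ H(ρ) + (1/4) log₂ F(ρ), where F(ρ) = (1−ρ)⁴ + 4ρ(1−ρ)³ + 6ρ²(1−ρ)². -/

import Mathlib

/-- The dual code `C⊥ = {x ∈ F₂ⁿ : x·c = 0 for all c ∈ C}`. -/
noncomputable def dualCode {n : ℕ} (C : Submodule (ZMod 2) (Fin n → ZMod 2)) :
    Submodule (ZMod 2) (Fin n → ZMod 2) where
  carrier := {x | ∀ c ∈ C, ∑ i, x i * c i = 0}
  zero_mem' := by intro c hc; simp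
  add_mem' := by
    intro a b ha hb c hc
    have h1 := ha c hc
    have h2 := hb c hc
    simp only [Pi.add_apply, add_mul, Finset.sum_add_distrib, h1, h2, add_zero]
  smul_mem' := by
    intro r a ha c hc
    have h := ha c hc
    simp only [Pi.smul_apply, smul_eq_mul, mul_assoc, ← Finset.mul_sum, h, mul_zero]
/-- `A_w(n,δ)`: the maximum cardinality of a linear code `C ≤ F₂ⁿ` whose dual `C⊥` is
spanned by vectors of Hamming weight at most `w` and whose minimum Hamming distance is
at least `δn`. -/
noncomputable def maxLDPCCard (w n : ℕ) (δ : ℝ) : ℕ :=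
  sSup {k | ∃ C : Submodule (ZMod 2) (Fin n → ZMod 2),
    (∃ S : Set (Fin n → ZMod 2), (∀ x ∈ S, hammingNorm x ≤ w) ∧
      Submodule.span (ZMod 2) S = dualCode C) ∧
    (∀ c ∈ C, c ≠ 0 → δ * n ≤ (hammingNorm c : ℝ)) ∧
    Nat.card C = k}

/-- `R_w(δ) = limsup_{n→∞} (1/n) log₂ A_w(n,δ)`. -/
noncomputable def LDPCRate (w : ℕ) (δ : ℝ) : ℝ :=
  Filter.limsup (fun n : ℕ => Real.logb 2 (maxLDPCCard w n δ) / n) Filter.atTop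

/-- The binary entropy function `H(x) = −x log₂ x − (1−x) log₂ (1−x)`. -/
noncomputable def binEnt (x : ℝ) : ℝ := -x * Real.logb 2 x - (1 - x) * Real.logb 2 (1 - x)

/-- The nontrivial real character of `ZMod 2`. -/
noncomputable def signChar (a : ZMod 2) : ℝ := if a = 0 then 1 else -1

theorem signChar_add (a b : ZMod 2) : signChar (a + b) = signChar a * signChar b := by
  have h : ∀ a : ZMod 2, a = 0 ∨ a = 1 := by decide
  have h1 : (1 : ZMod 2) + 1 = 0 := by decide
  rcases h a with rfl | rfl <;> rcases h b with rfl | rfl <;> simp [signChar, h1]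

theorem add_self_eq_zero_of_zmod_two {n : ℕ} (x : Fin n → ZMod 2) : x + x = 0 :=
  funext fun i => CharTwo.add_self_eq_zero (x i)

/-- The Walsh character of `F₂ⁿ` with frequency `c`. -/
noncomputable def walsh {n : ℕ} (c x : Fin n → ZMod 2) : ℝ := signChar (x ⬝ᵥ c)

theorem walsh_add {n : ℕ} (c x y : Fin n → ZMod 2) :
    walsh c (x + y) = walsh c x * walsh c y := by
  simp [walsh, add_dotProduct, signChar_add]

theorem walsh_comm {n : ℕ} (c x : Fin n → ZMod 2) : walsh c x = walsh x c := by
  simp [walsh, dotProduct_comm]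

theorem walsh_zero_left {n : ℕ} (x : Fin n → ZMod 2) : walsh 0 x = 1 := by
  simp [walsh, signChar]

theorem walsh_single {n : ℕ} (c : Fin n → ZMod 2) (i : Fin n) :
    walsh c (Pi.single i 1) = if c i = 0 then 1 else -1 := by
  simp [walsh, signChar]

theorem sum_walsh_single {n : ℕ} (c : Fin n → ZMod 2) :
    ∑ i, walsh c (Pi.single i 1) = n - 2 * (hammingNorm c : ℝ) := by
  have h : ∀ i, walsh c (Pi.single i 1) = 1 - 2 * (if c i ≠ 0 then 1 else 0 : ℝ) := by
    intro i
    rw [walsh_single]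
    by_cases hc : c i = 0 <;> norm_num [hc]
  simp_rw [h, Finset.sum_sub_distrib, ← Finset.mul_sum, Finset.sum_boole]
  simp [hammingNorm]

theorem sum_eq_zero_of_add_eq_neg {G : Type*} [AddGroup G] [Fintype G] {φ : G → ℝ} (g : G)
    (h : ∀ a, φ (a + g) = -φ a) : ∑ a, φ a = 0 := by
  have h1 : ∑ a, φ (a + g) = ∑ a, φ a := Equiv.sum_comp (Equiv.addRight g) φ
  simp only [h, Finset.sum_neg_distrib] at h1
  linarith

theorem sum_walsh {n : ℕ} (c : Fin n → ZMod 2) :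
    ∑ x, walsh c x = if c = 0 then 2 ^ n else 0 := by
  split_ifs with hc
  · simp [hc, walsh_zero_left]
  · obtain ⟨i, hi⟩ := Function.ne_iff.1 hc
    refine sum_eq_zero_of_add_eq_neg (Pi.single i 1) fun a => ?_
    have : c i ≠ 0 := hi
    simp [walsh_add, walsh_single, this]

theorem mem_dualCode {n : ℕ} {C : Submodule (ZMod 2) (Fin n → ZMod 2)} {x : Fin n → ZMod 2} :
    x ∈ dualCode C ↔ ∀ c ∈ C, x ⬝ᵥ c = 0 := Iff.rfl

open Classical in
theorem sum_walsh_submodule {n : ℕ} (C : Submodule (ZMod 2) (Fin n → ZMod 2))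
    (v : Fin n → ZMod 2) :
    ∑ c : C, walsh (c : Fin n → ZMod 2) v =
      if v ∈ dualCode C then (Fintype.card C : ℝ) else 0 := by
  split_ifs with hv
  · have : ∀ c : C, walsh (c : Fin n → ZMod 2) v = 1 := fun c => by
      simp [walsh, signChar, mem_dualCode.1 hv c c.2]
    simp [this]
  · rw [mem_dualCode] at hv
    push Not at hv
    obtain ⟨c, hc, hvc⟩ := hv
    refine sum_eq_zero_of_add_eq_neg (⟨c, hc⟩ : C) fun a => ?_
    rw [walsh_comm, Submodule.coe_add, walsh_add, walsh_comm v c, walsh_comm v]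
    simp [walsh, signChar, hvc]

theorem card_mul_card_dualCode {n : ℕ} (C : Submodule (ZMod 2) (Fin n → ZMod 2)) :
    Nat.card C * Nat.card (dualCode C) = 2 ^ n := by
  classical
  have h : ∑ x : Fin n → ZMod 2, ∑ c : C, walsh (c : Fin n → ZMod 2) x = 2 ^ n := by
    rw [Finset.sum_comm]
    simp [sum_walsh]
  simp_rw [sum_walsh_submodule, ← Finset.sum_filter, Finset.sum_const, nsmul_eq_mul] at h
  rw [Nat.card_eq_fintype_card, Nat.card_eq_fintype_card, mul_comm, Fintype.card_subtype]
  exact_mod_cast h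

theorem dualCode_dualCode {n : ℕ} (C : Submodule (ZMod 2) (Fin n → ZMod 2)) :
    dualCode (dualCode C) = C := by
  have hle : C ≤ dualCode (dualCode C) := fun c hc x hx => by
    rw [← dotProduct, dotProduct_comm]
    exact hx c hc
  have h1 := card_mul_card_dualCode C
  have h2 := card_mul_card_dualCode (dualCode C)
  rw [← h2, mul_comm] at h1
  have h3 := Nat.eq_of_mul_eq_mul_left Nat.card_pos h1
  symm
  apply SetLike.coe_injective
  exact Set.eq_of_subset_of_ncard_le hle (by simpa [← Nat.card_coe_set_eq] using h3.ge)

/-- If `f ≥ 0` is a `lam`-subharmonic function on the cube and `lam` exceeds all the nontrivial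
eigenvalues of the Cayley graph of `F₂ⁿ / C⊥`, then the translates of the support of `f` by `C⊥`
cover a fraction of at least `1 / (n + 1)` of the cube. -/
theorem two_pow_le_card_support_add_dualCode {n : ℕ}
    (C : Submodule (ZMod 2) (Fin n → ZMod 2)) {f : (Fin n → ZMod 2) → ℝ} (hf : ∀ x, 0 ≤ f x)
    (hpos : 0 < ∑ x, f x) {lam : ℝ} (hlam : 0 ≤ lam)
    (hA : ∀ x, lam * f x ≤ ∑ i, f (x + Pi.single i 1))
    (hC : ∀ c ∈ C, c ≠ 0 → n - 2 * (hammingNorm c : ℝ) + 1 ≤ lam)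
    {s : Finset (Fin n → ZMod 2)} (hs : ∀ x y, f y ≠ 0 → x + y ∈ dualCode C → x ∈ s) :
    (2 : ℝ) ^ n ≤ (n + 1) * s.card := by
  classical
  set fh : (Fin n → ZMod 2) → ℝ := fun c => ∑ y, f y * walsh c y with hfh
  set F : (Fin n → ZMod 2) → ℝ := fun x => ∑ c : C, fh c * walsh (c : Fin n → ZMod 2) x with hF
  set D : (Fin n → ZMod 2) → ℝ := fun x => if x ∈ dualCode C then (Fintype.card C : ℝ) else 0
    with hD
  have hD0 : ∀ x, 0 ≤ D x := fun x => by simp only [hD]; split_ifs <;> positivity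
  have hFD : ∀ x, F x = ∑ y, f y * D (x + y) := by
    intro x
    simp only [hF, hfh, hD, ← sum_walsh_submodule, Finset.sum_mul, Finset.mul_sum]
    rw [Finset.sum_comm]
    refine Finset.sum_congr rfl fun y _ => Finset.sum_congr rfl fun c _ => ?_
    rw [walsh_add]; ring
  have hF0 : ∀ x, 0 ≤ F x := fun x => by
    rw [hFD]; exact Finset.sum_nonneg fun y _ => mul_nonneg (hf y) (hD0 _)
  have hFs : ∀ x, x ∉ s → F x = 0 := fun x hx => by
    rw [hFD]
    refine Finset.sum_eq_zero fun y _ => ?_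
    by_contra h
    have h1 : f y ≠ 0 := left_ne_zero_of_mul h
    have h2 := right_ne_zero_of_mul h
    simp only [hD, ne_eq, ite_eq_right_iff, not_forall] at h2
    exact hx (hs x y h1 h2.1)
  have hsum : ∑ x, F x = 2 ^ n * fh 0 := by
    simp only [hF]
    rw [Finset.sum_comm]
    simp only [← Finset.mul_sum, sum_walsh]
    rw [Finset.sum_eq_single (0 : C)]
    · simp [mul_comm]
    · intro c _ hc
      simp [hc]
    · simp
  have hpair : ∀ w : C → ℝ, ∑ x, F x * ∑ c : C, w c * (fh c * walsh (c : Fin n → ZMod 2) x) =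
      2 ^ n * ∑ c : C, w c * fh c ^ 2 := by
    intro w
    have h1 : ∀ x, F x * ∑ c : C, w c * (fh c * walsh (c : Fin n → ZMod 2) x) =
        ∑ c : C, ∑ c' : C, fh c' * (w c * fh c) * walsh ((c' : Fin n → ZMod 2) + (c : Fin n → ZMod 2)) x := by
      intro x
      simp only [hF, Finset.sum_mul, Finset.mul_sum]
      refine Finset.sum_congr rfl fun c _ => Finset.sum_congr rfl fun c' _ => ?_
      rw [walsh_comm (_ + _), walsh_add, walsh_comm x, walsh_comm x]; ring
    simp only [h1]
    rw [Finset.sum_comm, Finset.mul_sum]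
    refine Finset.sum_congr rfl fun c _ => ?_
    rw [Finset.sum_comm, Finset.sum_eq_single c]
    · rw [← Finset.mul_sum, sum_walsh, if_pos (add_self_eq_zero_of_zmod_two _)]; ring
    · intro c' _ hc'
      rw [← Finset.mul_sum, sum_walsh, if_neg, mul_zero]
      intro h
      exact hc' (Subtype.ext (funext fun i => CharTwo.add_eq_zero.1 (congrFun h i)))
    · simp
  have hAF : ∀ x, ∑ i, F (x + Pi.single i 1) = ∑ c : C,
      (n - 2 * (hammingNorm (c : Fin n → ZMod 2) : ℝ)) *
        (fh c * walsh (c : Fin n → ZMod 2) x) := by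
    intro x
    simp only [hF]
    rw [Finset.sum_comm]
    refine Finset.sum_congr rfl fun c _ => ?_
    rw [← sum_walsh_single, Finset.sum_mul]
    exact Finset.sum_congr rfl fun i _ => by rw [walsh_add]; ring
  have hAF' : ∀ x, lam * F x ≤ ∑ i, F (x + Pi.single i 1) := by
    intro x
    have h1 : ∀ i, F (x + Pi.single i 1) = ∑ y, f (y + Pi.single i 1) * D (x + y) := by
      intro i
      rw [hFD, ← Equiv.sum_comp (Equiv.addRight (Pi.single i (1 : ZMod 2)))]
      refine Finset.sum_congr rfl fun y _ => ?_
      simp only [Equiv.coe_addRight]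
      rw [add_add_add_comm, add_self_eq_zero_of_zmod_two, add_zero]
    simp only [h1]
    rw [Finset.sum_comm, hFD, Finset.mul_sum]
    refine Finset.sum_le_sum fun y _ => ?_
    rw [← Finset.sum_mul, ← mul_assoc]
    exact mul_le_mul_of_nonneg_right (hA y) (hD0 _)
  have hsq : ∑ x, F x ^ 2 = 2 ^ n * ∑ c : C, fh c ^ 2 := by
    simpa [hF, sq] using hpair fun _ => 1
  have hquad : lam * (2 ^ n * ∑ c : C, fh c ^ 2) ≤ 2 ^ n * ∑ c : C,
      (n - 2 * (hammingNorm (c : Fin n → ZMod 2) : ℝ)) * fh c ^ 2 := by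
    rw [← hpair, ← hsq, Finset.mul_sum]
    refine Finset.sum_le_sum fun x _ => ?_
    rw [← hAF]
    nlinarith [mul_le_mul_of_nonneg_left (hAF' x) (hF0 x)]
  have hfh0 : 0 < fh 0 := by simpa [hfh, walsh_zero_left] using hpos
  clear_value D F
  have hener : ∑ c : C, fh c ^ 2 ≤ (n + 1) * fh 0 ^ 2 := by
    have h1 : lam * ∑ c : C, fh c ^ 2 ≤ ∑ c : C,
        (n - 2 * (hammingNorm (c : Fin n → ZMod 2) : ℝ)) * fh c ^ 2 := by
      refine le_of_mul_le_mul_left ?_ (by positivity : (0 : ℝ) < 2 ^ n)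
      linarith
    have h2 : ∀ c : C, fh c ^ 2 ≤ lam * fh c ^ 2 -
        (n - 2 * (hammingNorm (c : Fin n → ZMod 2) : ℝ)) * fh c ^ 2 +
          if c = 0 then (n + 1) * fh 0 ^ 2 else 0 := by
      intro c
      split_ifs with hc
      · subst hc
        simp only [Submodule.coe_zero, hammingNorm_zero]
        push_cast
        nlinarith [mul_nonneg hlam (sq_nonneg (fh 0))]
      · have := hC c c.2 (by simpa using hc)
        nlinarith [sq_nonneg (fh c)]
    have h3 := Finset.sum_le_sum fun c (_ : c ∈ Finset.univ) => h2 c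
    rw [Finset.sum_add_distrib, Finset.sum_sub_distrib, ← Finset.mul_sum, Finset.sum_ite_eq',
      if_pos (Finset.mem_univ _)] at h3
    linarith
  have hcs : (∑ x, F x) ^ 2 ≤ s.card * ∑ x, F x ^ 2 := by
    have e1 : ∑ x, F x = ∑ x ∈ s, F x :=
      (Finset.sum_subset (Finset.subset_univ s) fun x _ hx => hFs x hx).symm
    rw [e1]
    refine sq_sum_le_card_mul_sum_sq.trans ?_
    gcongr
    exact Finset.subset_univ s
  rw [hsum, hsq] at hcs
  have : (2 ^ n * fh 0 ^ 2) * (2 : ℝ) ^ n ≤ (2 ^ n * fh 0 ^ 2) * ((n + 1) * s.card) := by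
    calc _ = (2 ^ n * fh 0) ^ 2 := by ring
      _ ≤ _ := hcs
      _ ≤ s.card * (2 ^ n * ((n + 1) * fh 0 ^ 2)) := by gcongr
      _ = _ := by ring
  exact le_of_mul_le_mul_left this (by positivity)

open scoped symmDiff in
/-- The sets supported on `A` have representatives modulo the family `P`: a system of at most `2 ^ k`
sets, and another one, indexed with lower bounds for the weights, whose weight enumerator at `z`
is at most `(1 + z) ^ |A| * σ ^ k`. -/
def HasLeaderBound {α : Type} [DecidableEq α] (P : Finset α → Prop) (z σ : ℝ)
    (A : Finset α) : Prop :=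
  ∃ k : ℕ,
    (∃ (κ : Type) (_ : Fintype κ) (y : κ → Finset α),
      (∀ x ⊆ A, ∃ i, P (x ∆ y i)) ∧ Fintype.card κ ≤ 2 ^ k) ∧
    ∃ (ι : Type) (_ : Fintype ι) (y : ι → Finset α) (m : ι → ℕ),
      (∀ x ⊆ A, ∃ i, P (x ∆ y i) ∧ m i ≤ x.card) ∧
      ∑ i, z ^ m i ≤ (1 + z) ^ A.card * σ ^ k

open scoped symmDiff in
theorem hasLeaderBound_empty {α : Type} [DecidableEq α] {P : Finset α → Prop} (z σ : ℝ)
    (h0 : P ∅) : HasLeaderBound P z σ ∅ :=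
  ⟨0, ⟨Unit, inferInstance, fun _ => ∅, by simpa using h0, by simp⟩,
    Unit, inferInstance, fun _ => ∅, fun _ => 0, by simpa using h0, by simp⟩

/-- The subsets of `N` with at most one element, or with two elements other than `p`. -/
def lightSubsets {α : Type} [DecidableEq α] (N : Finset α) (p : α) : Finset (Finset α) :=
  N.powerset.filter fun s => s.card ≤ 1 ∨ (s.card = 2 ∧ p ∉ s)

theorem sum_lightSubsets_le {α : Type} [DecidableEq α] {N : Finset α} {p : α} (hp : p ∈ N)
    {z : ℝ} (hz : 0 ≤ z) :
    ∑ s ∈ lightSubsets N p, z ^ s.card ≤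
      1 + N.card * z + (N.card - 1).choose 2 * z ^ 2 := by
  have hsub : lightSubsets N p ⊆
      (N.powersetCard 0 ∪ N.powersetCard 1) ∪ (N.erase p).powersetCard 2 := by
    intro s hs
    simp only [lightSubsets, Finset.mem_filter, Finset.mem_powerset] at hs
    simp only [Finset.mem_union, Finset.mem_powersetCard, Finset.subset_erase]
    obtain ⟨h1, h2 | h2⟩ := hs
    · have : s.card = 0 ∨ s.card = 1 := by omega
      tauto
    · tauto
  have hc : ∀ (B : Finset α) (j : ℕ),
      ∑ s ∈ B.powersetCard j, z ^ s.card = B.card.choose j * z ^ j := by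
    intro B j
    rw [Finset.sum_congr rfl (g := fun _ => z ^ j)
      (fun s hs => by rw [(Finset.mem_powersetCard.1 hs).2])]
    simp
  have hu : ∀ B D : Finset (Finset α), ∑ s ∈ B ∪ D, z ^ s.card ≤
      ∑ s ∈ B, z ^ s.card + ∑ s ∈ D, z ^ s.card := by
    intro B D
    rw [← Finset.sum_union_inter]
    exact le_add_of_nonneg_right (Finset.sum_nonneg fun _ _ => by positivity)
  calc _ ≤ _ := Finset.sum_le_sum_of_subset_of_nonneg hsub (fun _ _ _ => by positivity)
    _ ≤ _ := hu _ _
    _ ≤ _ := add_le_add_left (hu _ _) _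
    _ = _ := by simp [hc, Finset.card_erase_of_mem hp]

open scoped symmDiff in
/-- Flipping a check of weight at most four makes the new part of a set light without increasing
the weight. -/
theorem exists_light_representative {α : Type} [DecidableEq α] {P : Finset α → Prop} (h0 : P ∅)
    {A T : Finset α} (hT : P T) (hT4 : T.card ≤ 4) (p : α) (x : Finset α) :
    ∃ x', P (x ∆ x') ∧ x' ⊆ x ∪ T ∧ x'.card ≤ x.card ∧
      x' ∩ (T \ A) ∈ lightSubsets (T \ A) p := by
  classical
  by_cases hx : x ∩ (T \ A) ∈ lightSubsets (T \ A) p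
  · exact ⟨x, by simpa using h0, Finset.subset_union_left, le_rfl, hx⟩
  set N := T \ A with hN
  have hNT : N ⊆ T := Finset.sdiff_subset
  have e1 : (x ∆ T) ∩ N = N \ (x ∩ N) := by
    ext a; have := @hNT a
    simp only [Finset.mem_inter, Finset.mem_symmDiff, Finset.mem_sdiff]; tauto
  have c1 : ((x ∆ T) ∩ N).card = N.card - (x ∩ N).card := by
    rw [e1, Finset.card_sdiff_of_subset Finset.inter_subset_right]
  have c2 : ((x ∆ T) \ N).card ≤ (x \ N).card + (T \ N).card := by
    refine (Finset.card_le_card (t := (x \ N) ∪ (T \ N)) ?_).trans (Finset.card_union_le _ _)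
    intro a
    simp only [Finset.mem_union, Finset.mem_symmDiff, Finset.mem_sdiff]; tauto
  have c3 := Finset.card_sdiff_add_card_inter (x ∆ T) N
  have c4 := Finset.card_sdiff_add_card_inter x N
  have c5 := Finset.card_sdiff_of_subset hNT
  have c6 := Finset.card_le_card hNT
  have c7 : (x ∩ N).card ≤ N.card := Finset.card_le_card Finset.inter_subset_right
  simp only [lightSubsets, Finset.mem_filter, Finset.mem_powerset, Finset.inter_subset_right,
    true_and, not_or, not_and, not_not, not_le] at hx
  refine ⟨x ∆ T, by simpa using hT, fun a ha => ?_, by omega, ?_⟩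
  · simp only [Finset.mem_union, Finset.mem_symmDiff] at ha ⊢; tauto
  · simp only [lightSubsets, Finset.mem_filter, Finset.mem_powerset, Finset.inter_subset_right,
      true_and]
    by_cases h2 : (x ∩ N).card = 2
    · have h3 : p ∉ (x ∆ T) ∩ N := by
        rw [e1]
        exact fun h => (Finset.mem_sdiff.1 h).2 (hx.2 h2)
      have : ((x ∆ T) ∩ N).card ≤ 1 ∨ ((x ∆ T) ∩ N).card = 2 := by omega
      tauto
    · left; omega

open scoped symmDiff in
theorem HasLeaderBound.union {α : Type} [DecidableEq α] {P : Finset α → Prop} {z σ : ℝ}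
    (h0 : P ∅) (hP : ∀ s t, P s → P t → P (s ∆ t)) (hz : 0 ≤ z) (hσ : 0 ≤ σ)
    (h2 : 1 + 2 * z ≤ (1 + z) ^ 2 * σ) (h3 : 1 + 3 * z + z ^ 2 ≤ (1 + z) ^ 3 * σ ^ 2)
    (h4 : 1 + 4 * z + 3 * z ^ 2 ≤ (1 + z) ^ 4 * σ ^ 3)
    {A T : Finset α} (hA : HasLeaderBound P z σ A) (hT : P T) (hT4 : T.card ≤ 4) {p : α}
    (hpT : p ∈ T) (hpA : p ∉ A) : HasLeaderBound P z σ (A ∪ T) := by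
  classical
  obtain ⟨k, ⟨κ, _, y, hy, hκ⟩, ι, _, y', m, hy', hm⟩ := hA
  set N := T \ A with hN
  have hNT : N ⊆ T := Finset.sdiff_subset
  have hpN : p ∈ N := by simp [hN, hpT, hpA]
  have hN4 : N.card ≤ 4 := (Finset.card_le_card hNT).trans hT4
  have hN1 : 1 ≤ N.card := Finset.card_pos.2 ⟨p, hpN⟩
  have hAT : A ∪ T = A ∪ N := by simp [hN]
  have hcard : (A ∪ T).card = A.card + N.card := by
    rw [hAT, Finset.card_union_of_disjoint Finset.disjoint_sdiff]
  have key : ∀ x x' w : Finset α, P (x ∆ x') → P ((x' \ N) ∆ w) → P (x ∆ (w ∆ (x' ∩ N))) := by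
    intro x x' w h h'
    have := hP _ _ h h'
    convert this using 1
    ext a
    simp only [Finset.mem_symmDiff, Finset.mem_inter, Finset.mem_sdiff]
    grind
  have hsub : ∀ x x' : Finset α, x ⊆ A ∪ T → x' ⊆ x ∪ T → x' \ N ⊆ A := by
    intro x x' h h' a ha
    have h1 := @h a
    have h2 := @h' a
    simp only [hN, Finset.mem_union, Finset.mem_sdiff] at h1 h2 ha; tauto
  refine ⟨k + (N.card - 1), ⟨κ × (N.erase p).powerset, inferInstance,
    fun i => y i.1 ∆ i.2.1, ?_, ?_⟩, ι × lightSubsets N p, inferInstance,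
    fun i => y' i.1 ∆ i.2.1, fun i => m i.1 + i.2.1.card, ?_, ?_⟩
  · intro x hx
    obtain ⟨x', hx', hxT, hpx⟩ : ∃ x', P (x ∆ x') ∧ x' ⊆ x ∪ T ∧ p ∉ x' := by
      by_cases hp : p ∈ x
      · refine ⟨x ∆ T, by simpa using hT, fun a ha => ?_, by simp [Finset.mem_symmDiff, hp, hpT]⟩
        simp only [Finset.mem_union, Finset.mem_symmDiff] at ha ⊢; tauto
      · exact ⟨x, by simpa using h0, Finset.subset_union_left, hp⟩
    obtain ⟨i, hi⟩ := hy (x' \ N) (hsub x x' hx hxT)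
    refine ⟨(i, ⟨x' ∩ N, ?_⟩), key x x' _ hx' hi⟩
    simp [Finset.subset_erase, hpx]
  · rw [Fintype.card_prod, Fintype.card_coe, Finset.card_powerset, Finset.card_erase_of_mem hpN,
      pow_add]
    exact Nat.mul_le_mul_right _ hκ
  · intro x hx
    obtain ⟨x', hx', hxT, hc, hl⟩ := exists_light_representative (A := A) h0 hT hT4 p x
    obtain ⟨i, hi, hmi⟩ := hy' (x' \ N) (hsub x x' hx hxT)
    refine ⟨(i, ⟨x' ∩ N, hl⟩), key x x' _ hx' hi, ?_⟩
    have := Finset.card_sdiff_add_card_inter x' N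
    simp only
    omega
  · have hprod : ∑ i : ι × lightSubsets N p, z ^ (m i.1 + i.2.1.card) =
        (∑ i, z ^ m i) * ∑ s ∈ lightSubsets N p, z ^ s.card := by
      rw [Fintype.sum_prod_type, Finset.sum_mul]
      refine Finset.sum_congr rfl fun i _ => ?_
      rw [← Finset.sum_coe_sort (lightSubsets N p), Finset.mul_sum]
      exact Finset.sum_congr rfl fun s _ => pow_add _ _ _
    have hlight : ∑ s ∈ lightSubsets N p, z ^ s.card ≤ (1 + z) ^ N.card * σ ^ (N.card - 1) := by
      refine (sum_lightSubsets_le hpN hz).trans ?_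
      generalize N.card = j at hN4 hN1
      interval_cases j
      · simp
      · simpa using h2
      · simpa using h3
      · simpa [Nat.choose] using h4
    rw [hprod, hcard, pow_add, pow_add]
    calc _ ≤ ((1 + z) ^ A.card * σ ^ k) * ((1 + z) ^ N.card * σ ^ (N.card - 1)) :=
          mul_le_mul hm hlight (Finset.sum_nonneg fun _ _ => by positivity) (by positivity)
      _ = _ := by ring

open scoped symmDiff in
theorem hasLeaderBound_univ {α : Type} [DecidableEq α] [Fintype α] {P : Finset α → Prop} {z σ : ℝ}
    (h0 : P ∅) (hP : ∀ s t, P s → P t → P (s ∆ t)) (hz : 0 ≤ z) (hσ : 0 ≤ σ)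
    (h2 : 1 + 2 * z ≤ (1 + z) ^ 2 * σ) (h3 : 1 + 3 * z + z ^ 2 ≤ (1 + z) ^ 3 * σ ^ 2)
    (h4 : 1 + 4 * z + 3 * z ^ 2 ≤ (1 + z) ^ 4 * σ ^ 3)
    (hcov : ∀ p, ∃ T, P T ∧ T.card ≤ 4 ∧ p ∈ T) : HasLeaderBound P z σ Finset.univ := by
  classical
  obtain ⟨A, hA⟩ := (Set.toFinite {A | HasLeaderBound P z σ A}).exists_maximal
    ⟨∅, hasLeaderBound_empty z σ h0⟩
  by_cases hu : A = Finset.univ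
  · exact hu ▸ hA.prop
  obtain ⟨p, hp⟩ : ∃ p, p ∉ A := by
    by_contra! h
    exact hu (Finset.eq_univ_iff_forall.2 h)
  obtain ⟨T, hT, hT4, hpT⟩ := hcov p
  have hB := HasLeaderBound.union h0 hP hz hσ h2 h3 h4 hA.prop hT hT4 hpT hp
  exact absurd (hA.le_of_ge hB Finset.subset_union_left (Finset.mem_union_right _ hpT)) hp

theorem leader_constants {z σ : ℝ} (hz : 0 < z) (hz1 : z ≤ 1)
    (hσ : σ = Real.exp (Real.log (1 + 3 * z) / 3) / (1 + z)) :
    0 < σ ∧ 1 + 2 * z ≤ (1 + z) ^ 2 * σ ∧ 1 + 3 * z + z ^ 2 ≤ (1 + z) ^ 3 * σ ^ 2 ∧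
      1 + 4 * z + 3 * z ^ 2 ≤ (1 + z) ^ 4 * σ ^ 3 := by
  set t := Real.exp (Real.log (1 + 3 * z) / 3) with ht
  have ht0 : 0 < t := Real.exp_pos _
  have ht3 : t ^ 3 = 1 + 3 * z := by
    rw [ht, ← Real.exp_nat_mul]
    rw [show ((3 : ℕ) : ℝ) * (Real.log (1 + 3 * z) / 3) = Real.log (1 + 3 * z) by push_cast; ring]
    exact Real.exp_log (by linarith)
  have e2 : (1 + z) ^ 2 * σ = (1 + z) * t := by rw [hσ]; field_simp
  have e3 : (1 + z) ^ 3 * σ ^ 2 = (1 + z) * t ^ 2 := by rw [hσ]; field_simp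
  have e4 : (1 + z) ^ 4 * σ ^ 3 = (1 + z) * t ^ 3 := by rw [hσ]; field_simp
  refine ⟨by rw [hσ]; positivity, ?_, ?_, ?_⟩
  · rw [e2]
    refine le_of_pow_le_pow_left₀ (n := 3) (by norm_num) (by positivity) ?_
    rw [mul_pow, ht3]
    nlinarith [pow_pos hz 3, pow_pos hz 4]
  · rw [e3]
    refine le_of_pow_le_pow_left₀ (n := 3) (by norm_num) (by positivity) ?_
    rw [mul_pow, ← pow_mul, show 2 * 3 = 3 * 2 by norm_num, pow_mul, ht3]
    have : z ^ 6 ≤ z ^ 3 := pow_le_pow_of_le_one hz.le hz1 (by norm_num)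
    nlinarith [pow_pos hz 3, pow_pos hz 4]
  · rw [e4, ht3]
    nlinarith

theorem log_two_mul_le {z : ℝ} (hz : 0 < z) (hz1 : z ≤ 1) :
    Real.log 2 * (4 * Real.log (1 + z) - Real.log (1 + 4 * z + 6 * z ^ 2)) ≤
      Real.log (1 + 4 * z + 6 * z ^ 2) * (Real.log (1 + z) - Real.log (1 + 3 * z) / 3) := by
  have hQ : (0 : ℝ) < 1 + 4 * z + 6 * z ^ 2 := by positivity
  have b1 : 4 * Real.log (1 + z) - Real.log (1 + 4 * z + 6 * z ^ 2) ≤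
      (4 * z ^ 3 + z ^ 4) / (1 + 4 * z + 6 * z ^ 2) := by
    have := Real.log_le_sub_one_of_pos (x := (1 + z) ^ 4 / (1 + 4 * z + 6 * z ^ 2)) (by positivity)
    rw [Real.log_div (by positivity) (by positivity), Real.log_pow] at this
    push_cast at this
    refine this.trans (le_of_eq ?_)
    field_simp
    ring
  have b2 : (4 * z + 6 * z ^ 2) / (1 + 2 * z + 3 * z ^ 2) ≤ Real.log (1 + 4 * z + 6 * z ^ 2) := by
    have := Real.le_log_one_add_of_nonneg (x := 4 * z + 6 * z ^ 2) (by positivity)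
    rw [← add_assoc] at this
    refine le_trans (le_of_eq ?_) this
    field_simp
    ring
  have b3 : 2 * (3 * z ^ 2 + z ^ 3) / (2 + 6 * z + 3 * z ^ 2 + z ^ 3) / 3 ≤
      Real.log (1 + z) - Real.log (1 + 3 * z) / 3 := by
    have := Real.le_log_one_add_of_nonneg (x := (3 * z ^ 2 + z ^ 3) / (1 + 3 * z)) (by positivity)
    rw [show 1 + (3 * z ^ 2 + z ^ 3) / (1 + 3 * z) = (1 + z) ^ 3 / (1 + 3 * z) by field_simp; ring,
      Real.log_div (by positivity) (by positivity), Real.log_pow] at this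
    push_cast at this
    have e : 2 * ((3 * z ^ 2 + z ^ 3) / (1 + 3 * z)) / ((3 * z ^ 2 + z ^ 3) / (1 + 3 * z) + 2) =
        2 * (3 * z ^ 2 + z ^ 3) / (2 + 6 * z + 3 * z ^ 2 + z ^ 3) := by
      field_simp
      ring
    rw [e] at this
    linarith
  have hl2 := Real.log_two_lt_d9
  calc _ ≤ Real.log 2 * ((4 * z ^ 3 + z ^ 4) / (1 + 4 * z + 6 * z ^ 2)) := by gcongr
    _ ≤ 0.7 * ((4 * z ^ 3 + z ^ 4) / (1 + 4 * z + 6 * z ^ 2)) := by gcongr; linarith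
    _ ≤ (4 * z + 6 * z ^ 2) / (1 + 2 * z + 3 * z ^ 2) *
        (2 * (3 * z ^ 2 + z ^ 3) / (2 + 6 * z + 3 * z ^ 2 + z ^ 3) / 3) := by
      rw [← mul_div_assoc, div_div, div_mul_div_comm, div_le_div_iff₀ (by positivity) (by positivity)]
      have : 0 ≤ z ^ 3 * (2 * (4 + 6 * z) * (3 + z) * (1 + 4 * z + 6 * z ^ 2) -
          0.7 * (4 + z) * ((1 + 2 * z + 3 * z ^ 2) * (3 * (2 + 6 * z + 3 * z ^ 2 + z ^ 3)))) := by
        apply mul_nonneg (by positivity)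
        have h5 : z ^ 5 ≤ z ^ 2 := pow_le_pow_of_le_one hz.le hz1 (by norm_num)
        have h6 : z ^ 6 ≤ z ^ 2 := pow_le_pow_of_le_one hz.le hz1 (by norm_num)
        have h4 : z ^ 4 ≤ z ^ 2 := pow_le_pow_of_le_one hz.le hz1 (by norm_num)
        nlinarith [pow_pos hz 2, pow_pos hz 3]
      nlinarith
    _ ≤ _ := mul_le_mul b2 b3 (by positivity) (Real.log_nonneg (by nlinarith))

theorem leader_bound_dichotomy {z σ : ℝ} (hz : 0 < z) (hz1 : z ≤ 1)
    (hσ : σ = Real.exp (Real.log (1 + 3 * z) / 3) / (1 + z)) (n k : ℕ) :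
    (2 : ℝ) ^ k ≤ Real.exp (n * (Real.log (1 + 4 * z + 6 * z ^ 2) / 4)) ∨
      (1 + z) ^ n * σ ^ k ≤ Real.exp (n * (Real.log (1 + 4 * z + 6 * z ^ 2) / 4)) := by
  have hσ0 : 0 < σ := (leader_constants hz hz1 hσ).1
  have hl2 : 0 < Real.log 2 := Real.log_pos (by norm_num)
  have hlσ : Real.log σ = Real.log (1 + 3 * z) / 3 - Real.log (1 + z) := by
    rw [hσ, Real.log_div (Real.exp_pos _).ne' (by positivity), Real.log_exp]
  set q := Real.log (1 + 4 * z + 6 * z ^ 2) / 4 with hq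
  have hmain : Real.log 2 * (Real.log (1 + z) - q) ≤ q * (-Real.log σ) := by
    have := log_two_mul_le hz hz1
    rw [hlσ, hq]; nlinarith
  have hσneg : 0 ≤ -Real.log σ := by
    rw [hlσ]
    have : Real.log (1 + 3 * z) ≤ Real.log ((1 + z) ^ 3) :=
      Real.log_le_log (by positivity) (by nlinarith [pow_pos hz 3, pow_pos hz 2])
    rw [Real.log_pow] at this
    push_cast at this
    linarith
  rw [← Real.log_le_iff_le_exp (by positivity), ← Real.log_le_iff_le_exp (by positivity),
    Real.log_mul (by positivity) (by positivity), Real.log_pow, Real.log_pow, Real.log_pow]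
  by_cases h : (k : ℝ) * Real.log 2 ≤ n * q
  · exact Or.inl h
  · right
    push Not at h
    have h1 : n * q * (-Real.log σ) ≤ k * Real.log 2 * (-Real.log σ) :=
      mul_le_mul_of_nonneg_right h.le hσneg
    have h2 : (n : ℝ) * (Real.log 2 * (Real.log (1 + z) - q)) ≤ n * (q * (-Real.log σ)) :=
      mul_le_mul_of_nonneg_left hmain (by positivity)
    have h3 : Real.log 2 * (n * Real.log (1 + z) + k * Real.log σ) ≤ Real.log 2 * (n * q) := by
      nlinarith
    exact le_of_mul_le_mul_left h3 hl2

theorem hammingNorm_add_single {n : ℕ} (x : Fin n → ZMod 2) (i : Fin n) :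
    hammingNorm (x + Pi.single i 1) =
      if x i = 0 then hammingNorm x + 1 else hammingNorm x - 1 := by
  classical
  have h : ∀ a : ZMod 2, a ≠ 0 → a + 1 = 0 := by decide
  unfold hammingNorm
  split_ifs with hx
  · rw [← Finset.card_insert_of_notMem (a := i) (by simp [hx])]
    congr 1
    ext j
    rcases eq_or_ne j i with rfl | hne
    · simp [hx]
    · simp [hne]
  · rw [← Finset.card_erase_of_mem (a := i) (by simp [hx])]
    congr 1
    ext j
    rcases eq_or_ne j i with rfl | hne
    · simp [h _ hx]
    · simp [hne]

theorem sum_radial_add_single {n : ℕ} (g : ℕ → ℝ) (x : Fin n → ZMod 2) :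
    ∑ i, g (hammingNorm (x + Pi.single i 1)) =
      hammingNorm x * g (hammingNorm x - 1) + (n - hammingNorm x) * g (hammingNorm x + 1) := by
  have h : ∀ i, g (hammingNorm (x + Pi.single i 1)) = g (hammingNorm x + 1) +
      (if x i ≠ 0 then 1 else 0) * (g (hammingNorm x - 1) - g (hammingNorm x + 1)) := by
    intro i
    rw [hammingNorm_add_single]
    by_cases hx : x i = 0 <;> simp [hx]
  simp_rw [h, Finset.sum_add_distrib, ← Finset.sum_mul, Finset.sum_boole]
  simp only [Finset.sum_const, Finset.card_univ, Fintype.card_fin, nsmul_eq_mul]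
  rw [show (Finset.univ.filter fun i => x i ≠ 0).card = hammingNorm x from rfl]
  ring

/-- A nonnegative subharmonic function supported on a Hamming ball of radius `a + M`. -/
theorem exists_subharmonic {n a M : ℕ} (ha : 1 ≤ a) (hM : 1 ≤ M) (h : a + M < n) :
    ∃ f : (Fin n → ZMod 2) → ℝ, (∀ x, 0 ≤ f x) ∧ 0 < ∑ x, f x ∧
      (∀ x, f x ≠ 0 → hammingNorm x ≤ a + M) ∧
      ∀ x, 2 * (1 - 1 / (M : ℝ)) * √(a * (n - a - M)) * f x ≤ ∑ i, f (x + Pi.single i 1) := by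
  classical
  have hb : (0 : ℝ) < n - a - M := by
    have : ((a + M : ℕ) : ℝ) < n := by exact_mod_cast h
    push_cast at this; linarith
  have ha0 : (0 : ℝ) < a := by exact_mod_cast ha
  have hM0 : (1 : ℝ) ≤ M := by exact_mod_cast hM
  set θ : ℝ := √a / √(n - a - M) with hθ
  have hθ0 : 0 < θ := by positivity
  set q : ℝ := √(a * (n - a - M)) with hq
  have hq0 : 0 ≤ q := Real.sqrt_nonneg _
  have hqθ : q * θ = a := by
    rw [hq, hθ, Real.sqrt_mul ha0.le]
    field_simp
    exact Real.sq_sqrt ha0.le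
  have hqθ' : (n - a - M) * θ = q := by
    rw [hq, hθ, Real.sqrt_mul ha0.le]
    field_simp
    rw [Real.sq_sqrt hb.le]
  set g : ℕ → ℝ := fun i => θ ^ i * (((i - a) * (a + M + 1 - i) : ℕ) : ℝ) with hg
  have hg0 : ∀ i, 0 ≤ g i := fun i => by positivity
  refine ⟨fun x => g (hammingNorm x), fun x => hg0 _, ?_, ?_, ?_⟩
  · obtain ⟨t, -, ht⟩ := Finset.exists_subset_card_eq
      (s := (Finset.univ : Finset (Fin n))) (n := a + 1) (by simp; omega)
    refine Finset.sum_pos' (fun x _ => hg0 _)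
      ⟨fun i => if i ∈ t then 1 else 0, Finset.mem_univ _, ?_⟩
    have : hammingNorm (fun i => if i ∈ t then (1 : ZMod 2) else 0) = a + 1 := by
      simp [hammingNorm, ht]
    rw [this]
    have : 0 < (a + 1 - a) * (a + M + 1 - (a + 1)) := by
      apply Nat.mul_pos <;> omega
    simp only [hg]
    positivity
  · intro x hx
    by_contra hlt
    apply hx
    simp only [hg]
    rw [show a + M + 1 - hammingNorm x = 0 by omega]
    simp
  · intro x
    rw [sum_radial_add_single]
    beta_reduce
    have hwn : hammingNorm x ≤ n := by simpa using hammingNorm_le_card_fintype (x := x)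
    generalize hammingNorm x = w at hwn
    have hwn' : (0 : ℝ) ≤ n - w := by
      have : (w : ℝ) ≤ n := by exact_mod_cast hwn
      linarith
    by_cases hw : a < w ∧ w ≤ a + M
    swap
    · have : g w = 0 := by
        simp only [hg]
        have : w - a = 0 ∨ a + M + 1 - w = 0 := by omega
        rcases this with h | h <;> simp [h]
      rw [this, mul_zero]
      exact add_nonneg (mul_nonneg (by positivity) (hg0 _)) (mul_nonneg hwn' (hg0 _))
    obtain ⟨u, rfl⟩ : ∃ u, w = a + u + 1 := ⟨w - a - 1, by omega⟩
    obtain ⟨v, rfl⟩ : ∃ v, M = u + v + 1 := ⟨M - u - 1, by omega⟩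
    have g1 : g (a + u + 1 - 1) = θ ^ (a + u) * (u * (v + 2)) := by
      simp only [hg]
      rw [show a + u + 1 - 1 = a + u by omega, show a + u - a = u by omega,
        show a + (u + v + 1) + 1 - (a + u) = v + 2 by omega]
      push_cast; ring
    have g2 : g (a + u + 1) = θ ^ (a + u) * θ * ((u + 1) * (v + 1)) := by
      simp only [hg]
      rw [show a + u + 1 - a = u + 1 by omega,
        show a + (u + v + 1) + 1 - (a + u + 1) = v + 1 by omega]
      push_cast; ring
    have g3 : g (a + u + 1 + 1) = θ ^ (a + u) * θ ^ 2 * ((u + 2) * v) := by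
      simp only [hg]
      rw [show a + u + 1 + 1 - a = u + 2 by omega,
        show a + (u + v + 1) + 1 - (a + u + 1 + 1) = v by omega]
      push_cast; ring
    rw [g1, g2, g3]
    push_cast at hqθ' hM0 ⊢
    have i1 : q * θ * (u * (v + 2)) ≤ (a + u + 1) * (u * (v + 2) : ℝ) := by
      rw [hqθ]
      gcongr
      linarith [(Nat.cast_nonneg u : (0 : ℝ) ≤ u)]
    have i2 : q * θ * ((u + 2) * v) ≤ (n - (a + u + 1)) * θ ^ 2 * ((u + 2) * v : ℝ) := by
      rw [← hqθ', mul_assoc _ θ θ, ← sq]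
      have hv : (n : ℝ) - a - (u + v + 1) ≤ n - (a + u + 1) := by
        linarith [(Nat.cast_nonneg v : (0 : ℝ) ≤ v)]
      exact mul_le_mul_of_nonneg_right (mul_le_mul_of_nonneg_right hv (by positivity))
        (by positivity)
    have i3 : 2 * (1 - 1 / ((u : ℝ) + v + 1)) * ((u + 1) * (v + 1)) ≤
        u * (v + 2) + (u + 2) * v := by
      have : (1 : ℝ) ≤ 1 / ((u : ℝ) + v + 1) * ((u + 1) * (v + 1)) := by
        rw [one_div_mul_eq_div, le_div_iff₀ (by positivity)]
        nlinarith [mul_nonneg (Nat.cast_nonneg u : (0 : ℝ) ≤ u) (Nat.cast_nonneg v : (0 : ℝ) ≤ v)]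
      nlinarith
    calc _ = θ ^ (a + u) * (q * θ * (2 * (1 - 1 / ((u : ℝ) + v + 1)) * ((u + 1) * (v + 1)))) := by
          ring
      _ ≤ θ ^ (a + u) * (q * θ * (u * (v + 2) + (u + 2) * v)) := by gcongr
      _ ≤ θ ^ (a + u) * ((a + u + 1) * (u * (v + 2) : ℝ) +
          (n - (a + u + 1)) * θ ^ 2 * ((u + 2) * v : ℝ)) := by
        gcongr
        linarith
      _ = _ := by ring

/-- The indicator vector of a set of coordinates. -/
def indicatorVec {n : ℕ} (s : Finset (Fin n)) : Fin n → ZMod 2 := fun i => if i ∈ s then 1 else 0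

open scoped symmDiff in
theorem indicatorVec_symmDiff {n : ℕ} (s t : Finset (Fin n)) :
    indicatorVec (s ∆ t) = indicatorVec s + indicatorVec t := by
  have h : (1 : ZMod 2) + 1 = 0 := by decide
  ext i
  by_cases hs : i ∈ s <;> by_cases ht : i ∈ t <;>
    simp [indicatorVec, Finset.mem_symmDiff, hs, ht, h]

theorem exists_indicatorVec_eq {n : ℕ} (x : Fin n → ZMod 2) :
    ∃ s, indicatorVec s = x ∧ s.card = hammingNorm x := by
  have h : ∀ a : ZMod 2, a ≠ 0 → a = 1 := by decide
  refine ⟨Finset.univ.filter fun i => x i ≠ 0, ?_, rfl⟩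
  ext i
  by_cases hx : x i = 0
  · simp [indicatorVec, hx]
  · simp [indicatorVec, h _ hx]

open Classical in
theorem card_biUnion_coset_le {n : ℕ} {ι : Type*} (K : Submodule (ZMod 2) (Fin n → ZMod 2))
    (J : Finset ι) (y : ι → Fin n → ZMod 2) :
    (J.biUnion fun i => Finset.univ.filter fun x => x + y i ∈ K).card ≤ J.card * Nat.card K := by
  refine Finset.card_biUnion_le_card_mul _ _ _ fun i _ => ?_
  rw [Nat.card_eq_fintype_card, Fintype.card_subtype]
  exact Finset.card_le_card_of_injOn (· + y i) (by intro x; simp)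
    ((add_left_injective _).injOn)

open scoped symmDiff in
theorem card_code_le_of_hasLeaderBound {n r : ℕ} {C : Submodule (ZMod 2) (Fin n → ZMod 2)}
    {z σ : ℝ} (hz : 0 < z) (hz1 : z ≤ 1)
    (hL : HasLeaderBound (fun s => indicatorVec s ∈ dualCode C) z σ Finset.univ)
    {f : (Fin n → ZMod 2) → ℝ} (hf : ∀ x, 0 ≤ f x) (hpos : 0 < ∑ x, f x)
    (hr : ∀ x, f x ≠ 0 → hammingNorm x ≤ r) {lam : ℝ} (hlam : 0 ≤ lam)
    (hA : ∀ x, lam * f x ≤ ∑ i, f (x + Pi.single i 1))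
    (hC : ∀ c ∈ C, c ≠ 0 → n - 2 * (hammingNorm c : ℝ) + 1 ≤ lam) :
    ∃ k : ℕ, (Nat.card C : ℝ) ≤ 2 ^ k ∧
      (Nat.card C : ℝ) ≤ (n + 1) * (((1 + z) ^ n * σ ^ k) / z ^ r) := by
  classical
  obtain ⟨k, ⟨κ, _, y, hy, hκ⟩, ι, _, y', m, hy', hm⟩ := hL
  have hcard : (Nat.card C : ℝ) * Nat.card (dualCode C) = 2 ^ n := by
    exact_mod_cast card_mul_card_dualCode C
  have hdual : (0 : ℝ) < Nat.card (dualCode C) := by exact_mod_cast Nat.card_pos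
  refine ⟨k, ?_, ?_⟩
  · have h1 := card_biUnion_coset_le (dualCode C) Finset.univ fun i => indicatorVec (y i)
    rw [(Finset.eq_univ_iff_forall (s := Finset.univ.biUnion _)).2] at h1
    · have h2 : (2 : ℝ) ^ n ≤ Fintype.card κ * Nat.card (dualCode C) := by
        have : 2 ^ n ≤ Fintype.card κ * Nat.card (dualCode C) := by simpa using h1
        exact_mod_cast this
      rw [← hcard] at h2
      exact (le_of_mul_le_mul_right h2 hdual).trans (by exact_mod_cast hκ)
    · intro x
      obtain ⟨s, rfl, -⟩ := exists_indicatorVec_eq x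
      obtain ⟨i, hi⟩ := hy s (Finset.subset_univ s)
      rw [indicatorVec_symmDiff] at hi
      simpa using ⟨i, hi⟩
  · set J : Finset ι := Finset.univ.filter fun i => m i ≤ r with hJ
    have h1 := card_biUnion_coset_le (dualCode C) J fun i => indicatorVec (y' i)
    have h2 := two_pow_le_card_support_add_dualCode C hf hpos hlam hA hC
      (s := J.biUnion fun i => Finset.univ.filter fun x => x + indicatorVec (y' i) ∈ dualCode C) (by
        intro x v hv hxv
        obtain ⟨s, rfl, hs⟩ := exists_indicatorVec_eq v
        obtain ⟨i, hi, hmi⟩ := hy' s (Finset.subset_univ s)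
        rw [indicatorVec_symmDiff] at hi
        have h3 := (dualCode C).add_mem hxv hi
        rw [add_assoc, ← add_assoc (indicatorVec s), add_self_eq_zero_of_zmod_two, zero_add] at h3
        simp only [Finset.mem_biUnion, Finset.mem_filter, Finset.mem_univ, true_and, hJ]
        exact ⟨i, hmi.trans (hs.trans_le (hr _ hv)), h3⟩)
    have h3 : (J.card : ℝ) * z ^ r ≤ (1 + z) ^ n * σ ^ k := by
      calc (J.card : ℝ) * z ^ r = ∑ i ∈ J, z ^ r := by simp
        _ ≤ ∑ i ∈ J, z ^ m i := Finset.sum_le_sum fun i hi =>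
          pow_le_pow_of_le_one hz.le hz1 (Finset.mem_filter.1 hi).2
        _ ≤ ∑ i, z ^ m i := Finset.sum_le_sum_of_subset_of_nonneg (Finset.subset_univ _)
          fun i _ _ => by positivity
        _ ≤ _ := by simpa using hm
    have h4 : (Nat.card C : ℝ) * Nat.card (dualCode C) ≤
        ((n + 1) * J.card) * Nat.card (dualCode C) := by
      rw [hcard, mul_assoc]
      refine h2.trans ?_
      gcongr
      exact_mod_cast h1
    refine (le_of_mul_le_mul_right h4 hdual).trans ?_
    gcongr
    rwa [le_div_iff₀ (by positivity)]

theorem exists_light_check {n : ℕ} {C : Submodule (ZMod 2) (Fin n → ZMod 2)}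
    {S : Set (Fin n → ZMod 2)} {w : ℕ} (hS : ∀ x ∈ S, hammingNorm x ≤ w)
    (hspan : Submodule.span (ZMod 2) S = dualCode C)
    (hC : ∀ c ∈ C, c ≠ 0 → 1 < hammingNorm c) (p : Fin n) :
    ∃ T, indicatorVec T ∈ dualCode C ∧ T.card ≤ w ∧ p ∈ T := by
  by_contra! hT
  have h0 : ∀ x ∈ S, x p = 0 := by
    intro x hx
    obtain ⟨s, rfl, hs⟩ := exists_indicatorVec_eq x
    have := hT s (hspan ▸ Submodule.subset_span hx) (hs.trans_le (hS _ hx))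
    simp [indicatorVec, this]
  have h1 : ∀ x ∈ dualCode C, x p = 0 := by
    intro x hx
    rw [← hspan] at hx
    exact (Submodule.span_le (p := LinearMap.ker (LinearMap.proj (R := ZMod 2)
      (φ := fun _ : Fin n => ZMod 2) p))).2 h0 hx
  have h2 : Pi.single p (1 : ZMod 2) ∈ C := by
    rw [← dualCode_dualCode C, mem_dualCode]
    intro x hx
    simp [h1 x hx]
  have h3 := hC _ h2 (by simp)
  have h4 := hammingNorm_add_single (0 : Fin n → ZMod 2) p
  simp only [zero_add, hammingNorm_zero, Pi.zero_apply, if_true] at h4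
  omega

theorem maxLDPCCard_le {n a M : ℕ} {δ z : ℝ} (hz : 0 < z) (hz1 : z ≤ 1) (hδn : 1 < δ * n)
    (ha : 1 ≤ a) (hM : 1 ≤ M) (haM : a + M < n)
    (hlam : n - 2 * (δ * n) + 1 ≤ 2 * (1 - 1 / (M : ℝ)) * √(a * (n - a - M))) :
    (maxLDPCCard 4 n δ : ℝ) ≤
      (n + 1) * (Real.exp (n * (Real.log (1 + 4 * z + 6 * z ^ 2) / 4)) / z ^ (a + M)) := by
  set E := Real.exp (n * (Real.log (1 + 4 * z + 6 * z ^ 2) / 4)) with hE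
  set σ := Real.exp (Real.log (1 + 3 * z) / 3) / (1 + z) with hσ
  obtain ⟨hσ0, h2, h3, h4⟩ := leader_constants hz hz1 hσ
  rcases Set.eq_empty_or_nonempty {k | ∃ C : Submodule (ZMod 2) (Fin n → ZMod 2),
    (∃ S : Set (Fin n → ZMod 2), (∀ x ∈ S, hammingNorm x ≤ 4) ∧
      Submodule.span (ZMod 2) S = dualCode C) ∧
    (∀ c ∈ C, c ≠ 0 → δ * n ≤ (hammingNorm c : ℝ)) ∧ Nat.card C = k} with hemp | hne
  · rw [maxLDPCCard, hemp]
    simp only [csSup_empty, bot_eq_zero', Nat.cast_zero]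
    positivity
  have hmem := Nat.sSup_mem hne ⟨2 ^ n, by
    rintro k ⟨C, -, -, rfl⟩
    rw [← card_mul_card_dualCode C]
    exact Nat.le_mul_of_pos_right _ Nat.card_pos⟩
  obtain ⟨C, ⟨S, hS, hspan⟩, hdist, hcard⟩ := hmem
  rw [maxLDPCCard, ← hcard]
  have hcov := exists_light_check hS hspan fun c hc hc0 => by
    exact_mod_cast hδn.trans_le (hdist c hc hc0)
  have hL := hasLeaderBound_univ (P := fun s => indicatorVec s ∈ dualCode C) (z := z) (σ := σ)
    (by convert (dualCode C).zero_mem; ext i; simp [indicatorVec])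
    (fun s t hs ht => by rw [indicatorVec_symmDiff]; exact (dualCode C).add_mem hs ht)
    hz.le hσ0.le h2 h3 h4 hcov
  obtain ⟨f, hf, hpos, hr, hA⟩ := exists_subharmonic ha hM haM
  have hM1 : 1 / (M : ℝ) ≤ 1 := by
    rw [div_le_one (by exact_mod_cast hM)]
    exact_mod_cast hM
  obtain ⟨k, hk1, hk2⟩ := card_code_le_of_hasLeaderBound hz hz1 hL hf hpos hr
    (mul_nonneg (by linarith) (Real.sqrt_nonneg _)) hA fun c hc hc0 => by
      have := hdist c hc hc0
      linarith
  rcases leader_bound_dichotomy hz hz1 hσ n k with h | h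
  · have e1 : E ≤ E / z ^ (a + M) :=
      le_div_self (Real.exp_pos _).le (by positivity) (pow_le_one₀ hz.le hz1)
    have e2 : E / z ^ (a + M) ≤ (n + 1) * (E / z ^ (a + M)) :=
      le_mul_of_one_le_left (by positivity) (by linarith [(Nat.cast_nonneg n : (0 : ℝ) ≤ n)])
    exact hk1.trans (h.trans (e1.trans e2))
  · refine hk2.trans ?_
    gcongr

theorem tendsto_log_succ_div : Filter.Tendsto (fun n : ℕ => Real.log (n + 1) / n)
    Filter.atTop (nhds 0) := by
  have h := (Real.tendsto_pow_log_div_mul_add_atTop 1 (-1) 1 one_ne_zero).comp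
    (Filter.tendsto_atTop_add_const_right _ 1 (tendsto_natCast_atTop_atTop (R := ℝ)))
  refine h.congr fun n => ?_
  simp

theorem LDPCRate_four_le_of_lt {δ α z : ℝ} (hδ0 : 0 < δ) (hα0 : 0 < α) (hα1 : α < 1)
    (hz : 0 < z) (hz1 : z ≤ 1) (hαδ : 1 - 2 * δ < 2 * √(α * (1 - α))) :
    LDPCRate 4 δ ≤
      (Real.log (1 + 4 * z + 6 * z ^ 2) / 4 - α * Real.log z) / Real.log 2 := by
  set q := Real.log (1 + 4 * z + 6 * z ^ 2) / 4 with hq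
  have hl2 : 0 < Real.log 2 := Real.log_pos (by norm_num)
  have hq0 : 0 ≤ q := div_nonneg (Real.log_nonneg (by nlinarith)) (by norm_num)
  have hlz : Real.log z ≤ 0 := Real.log_nonpos hz.le hz1
  have hinv : Filter.Tendsto (fun n : ℕ => 1 / (n : ℝ)) Filter.atTop (nhds 0) :=
    tendsto_one_div_atTop_nhds_zero_nat
  obtain ⟨M, hM1, hM⟩ : ∃ M : ℕ, 1 ≤ M ∧
      1 - 2 * δ < 2 * (1 - 1 / (M : ℝ)) * √(α * (1 - α)) := by
    have ht : Filter.Tendsto (fun M : ℕ => 2 * (1 - 1 / (M : ℝ)) * √(α * (1 - α)))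
        Filter.atTop (nhds (2 * (1 - 0) * √(α * (1 - α)))) :=
      ((hinv.const_sub 1).const_mul 2).mul_const _
    rw [sub_zero, mul_one] at ht
    exact ((Filter.eventually_ge_atTop 1).and (ht.eventually_const_lt hαδ)).exists
  have hMinv : 1 / (M : ℝ) ≤ 1 := by
    rw [div_le_one (by exact_mod_cast hM1)]
    exact_mod_cast hM1
  have hlim : Filter.Tendsto (fun n : ℕ => (Real.log (n + 1) / n + q -
      (α + (M + 1) * (1 / (n : ℝ))) * Real.log z) / Real.log 2) Filter.atTop
      (nhds ((q - α * Real.log z) / Real.log 2)) := by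
    have := ((tendsto_log_succ_div.add_const q).sub
      (((hinv.const_mul ((M : ℝ) + 1)).const_add α).mul_const (Real.log z))).div_const (Real.log 2)
    simpa using this
  have hlam : ∀ᶠ n : ℕ in Filter.atTop, 1 - 2 * δ + 1 / (n : ℝ) <
      2 * (1 - 1 / (M : ℝ)) * √(α * (1 - α - (M + 1) * (1 / (n : ℝ)))) := by
    have h1 : Filter.Tendsto (fun n : ℕ => 1 - 2 * δ + 1 / (n : ℝ)) Filter.atTop
        (nhds (1 - 2 * δ)) := by simpa using hinv.const_add (1 - 2 * δ)
    have h2 : Filter.Tendsto (fun n : ℕ => 2 * (1 - 1 / (M : ℝ)) *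
        √(α * (1 - α - (M + 1) * (1 / (n : ℝ))))) Filter.atTop
        (nhds (2 * (1 - 1 / (M : ℝ)) * √(α * (1 - α)))) := by
      have := ((((hinv.const_mul ((M : ℝ) + 1)).const_sub (1 - α)).const_mul α).sqrt).const_mul
        (2 * (1 - 1 / (M : ℝ)))
      simpa using this
    exact h1.eventually_lt h2 hM
  have hroom : ∀ᶠ n : ℕ in Filter.atTop, (M + 1) * (1 / (n : ℝ)) < 1 - α := by
    have := hinv.const_mul ((M : ℝ) + 1)
    rw [mul_zero] at this
    exact this.eventually_lt_const (by linarith)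
  have hδn : ∀ᶠ n : ℕ in Filter.atTop, 1 / (n : ℝ) < δ := hinv.eventually_lt_const hδ0
  have hev : ∀ᶠ n : ℕ in Filter.atTop, Real.logb 2 (maxLDPCCard 4 n δ) / n ≤
      (Real.log (n + 1) / n + q - (α + (M + 1) * (1 / (n : ℝ))) * Real.log z) / Real.log 2 := by
    filter_upwards [hlam, hroom, hδn, Filter.eventually_gt_atTop 0] with n h1 h2 h3 hn
    have hn0 : (0 : ℝ) < n := by exact_mod_cast hn
    have hnn : (n : ℝ) * (1 / n) = 1 := by field_simp
    set a := ⌈α * n⌉₊ with ha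
    have ha1 : α * n ≤ a := Nat.le_ceil _
    have ha2 : (a : ℝ) < α * n + 1 := Nat.ceil_lt_add_one (by positivity)
    have h2' : (M : ℝ) + 1 < (1 - α) * n := by
      have := mul_lt_mul_of_pos_right h2 hn0
      nlinarith
    have haM : a + M < n := by
      have : (a : ℝ) + M < n := by linarith
      exact_mod_cast this
    have hsqrt : n * √(α * (1 - α - (M + 1) * (1 / (n : ℝ)))) ≤ √(a * (n - a - M)) := by
      apply Real.le_sqrt_of_sq_le
      have h0 : 0 ≤ 1 - α - (M + 1) * (1 / (n : ℝ)) := by linarith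
      rw [mul_pow, Real.sq_sqrt (by positivity)]
      calc _ = (α * n) * ((1 - α) * n - (M + 1) * (n * (1 / n))) := by ring
        _ ≤ a * (n - a - M) := by
          rw [hnn]
          apply mul_le_mul ha1 <;> nlinarith
    have hcard := maxLDPCCard_le (a := a) (M := M) hz hz1
      (by rwa [div_lt_iff₀ hn0] at h3) (Nat.ceil_pos.2 (by positivity)) hM1 haM (by
        calc _ = n * (1 - 2 * δ + 1 / n) := by field_simp
          _ ≤ n * (2 * (1 - 1 / (M : ℝ)) * √(α * (1 - α - (M + 1) * (1 / (n : ℝ))))) := by gcongr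
          _ = 2 * (1 - 1 / (M : ℝ)) * (n * √(α * (1 - α - (M + 1) * (1 / (n : ℝ))))) := by ring
          _ ≤ _ := mul_le_mul_of_nonneg_left hsqrt (by linarith))
    rw [← hq] at hcard
    have hlog : Real.log (maxLDPCCard 4 n δ) ≤
        Real.log (n + 1) + (n * q - (a + M : ℕ) * Real.log z) := by
      rcases Nat.eq_zero_or_pos (maxLDPCCard 4 n δ) with h | h
      · rw [h, Nat.cast_zero, Real.log_zero]
        have := Real.log_nonneg (by linarith : (1 : ℝ) ≤ n + 1)
        have := mul_nonneg (Nat.cast_nonneg (a + M) : (0 : ℝ) ≤ (a + M : ℕ)) (neg_nonneg.2 hlz)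
        nlinarith
      · refine (Real.log_le_log (by exact_mod_cast h) hcard).trans (le_of_eq ?_)
        rw [Real.log_mul (by positivity) (by positivity), Real.log_div (by positivity)
          (by positivity), Real.log_exp, Real.log_pow]
    rw [Real.logb, div_right_comm]
    gcongr
    rw [div_le_iff₀ hn0]
    refine hlog.trans ?_
    push_cast
    have e : (Real.log (n + 1) / n + q - (α + (M + 1) * (1 / (n : ℝ))) * Real.log z) * n =
        Real.log (n + 1) + (n * q - (α * n + (M + 1)) * Real.log z) := by
      field_simp
      ring
    rw [e]
    nlinarith
  have hnonneg : ∀ n : ℕ, 0 ≤ Real.logb 2 (maxLDPCCard 4 n δ) / n := fun n =>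
    div_nonneg (div_nonneg (Real.log_natCast_nonneg _) hl2.le) (Nat.cast_nonneg _)
  rw [LDPCRate, ← hlim.limsup_eq]
  exact Filter.limsup_le_limsup hev
    (Filter.isCoboundedUnder_le_of_le Filter.atTop (x := 0) hnonneg)
    hlim.isBoundedUnder_le

/-- for `δ ∈ (0,1/2)` and `ρ = 1/2 − √(δ(1−δ))`,
`R₄(δ) ≤ H(ρ) + (1/4) log₂ F(ρ)` with `F(ρ) = (1−ρ)⁴ + 4ρ(1−ρ)³ + 6ρ²(1−ρ)²`. -/
theorem LDPCRate_four_le (δ : ℝ) (hδ0 : 0 < δ) (hδ2 : δ < 1 / 2)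
    (ρ : ℝ) (hρ : ρ = 1 / 2 - Real.sqrt (δ * (1 - δ))) :
    LDPCRate 4 δ ≤ binEnt ρ + (1 / 4) * Real.logb 2
      ((1 - ρ) ^ 4 + 4 * ρ * (1 - ρ) ^ 3 + 6 * ρ ^ 2 * (1 - ρ) ^ 2) := by
  set s := Real.sqrt (δ * (1 - δ)) with hs
  have hs2 : s ^ 2 = δ * (1 - δ) := Real.sq_sqrt (by nlinarith)
  have hs0 : 0 < s := Real.sqrt_pos.2 (by nlinarith)
  have hs1 : s < 1 / 2 := by
    by_contra! h
    nlinarith [sq_pos_of_pos (by linarith : (0 : ℝ) < 1 / 2 - δ)]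
  have hρ0 : 0 < ρ := by linarith
  have hρ1 : ρ < 1 / 2 := by linarith
  have hl2 : Real.log 2 ≠ 0 := (Real.log_pos (by norm_num)).ne'
  set z := ρ / (1 - ρ) with hz
  have h1ρ : 0 < 1 - ρ := by linarith
  have hz0 : 0 < z := div_pos hρ0 h1ρ
  have hz1 : z ≤ 1 := (div_le_one h1ρ).2 (by linarith)
  have hF : (1 - ρ) ^ 4 + 4 * ρ * (1 - ρ) ^ 3 + 6 * ρ ^ 2 * (1 - ρ) ^ 2 =
      (1 - ρ) ^ 4 * (1 + 4 * z + 6 * z ^ 2) := by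
    rw [hz]; field_simp
  have hRHS : binEnt ρ + (1 / 4) * Real.logb 2
      ((1 - ρ) ^ 4 + 4 * ρ * (1 - ρ) ^ 3 + 6 * ρ ^ 2 * (1 - ρ) ^ 2) =
      (Real.log (1 + 4 * z + 6 * z ^ 2) / 4 - ρ * Real.log z) / Real.log 2 := by
    have hlz : Real.log z = Real.log ρ - Real.log (1 - ρ) := Real.log_div hρ0.ne' h1ρ.ne'
    rw [hF, binEnt, Real.logb, Real.logb, Real.logb, Real.log_mul (by positivity) (by positivity),
      Real.log_pow, hlz]
    field_simp
    push_cast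
    ring
  rw [hRHS]
  have hlim : Filter.Tendsto
      (fun α => (Real.log (1 + 4 * z + 6 * z ^ 2) / 4 - α * Real.log z) / Real.log 2)
      (nhdsWithin ρ (Set.Ioi ρ))
      (nhds ((Real.log (1 + 4 * z + 6 * z ^ 2) / 4 - ρ * Real.log z) / Real.log 2)) :=
    (Continuous.tendsto (by fun_prop) ρ).mono_left nhdsWithin_le_nhds
  refine ge_of_tendsto hlim ?_
  filter_upwards [Ioo_mem_nhdsGT hρ1] with α hα
  refine LDPCRate_four_le_of_lt hδ0 (hρ0.trans hα.1) (by linarith [hα.2]) hz0 hz1 ?_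
  have : (1 - 2 * δ) / 2 < √(α * (1 - α)) := by
    apply Real.lt_sqrt_of_sq_lt
    have h1 : ρ * (1 - ρ) = (1 - 2 * δ) ^ 2 / 4 := by rw [hρ]; nlinarith
    have h2 := mul_pos (sub_pos.2 hα.1) (by linarith [hα.2] : 0 < 1 - ρ - α)
    nlinarith
  linarith
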